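/- arXiv:1111.5652 — 2 statements merged into one kernel-verified Lean document; each statement's English description precedes it below -/
import Mathlib

section
/- The theory of equality (EUF, the empty theory in first-order logic with equality) has the ground interpolation property: for all quantifier-free sentences A and B over signatures of function symbols such that {A, B} is unsatisfiable in first-order logic with equality, there exists a quantifier-free sentence I all of whose function symbols occur in both A and B such that A ⊨ I and {B, I} is unsatisfiable. -/
open FirstOrder Language

universe u v

/-- Value of a ground term in a structure. -/
def gval {L : FirstOrder.Language.{u, v}} (M : Type) (str : L.Structure M)
    (t : L.Term Empty) : M :=
  letI := str
  t.realize Empty.elim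

/-- A function symbol (paired with its arity) occurs in a term. -/
inductive TFunc {L : FirstOrder.Language.{u, v}} {α : Type*} :
    (Σ n, L.Functions n) → L.Term α → Prop
  | head {k : ℕ} (f : L.Functions k) (ts : Fin k → L.Term α) : TFunc ⟨k, f⟩ (Term.func f ts)
  | arg {k : ℕ} (f : L.Functions k) (ts : Fin k → L.Term α) (i : Fin k) {g} :
      TFunc g (ts i) → TFunc g (Term.func f ts)

/-- Quantifier-free sentences over a signature of function symbols: Boolean
combinations of equations between ground terms. -/
inductive QFF (L : FirstOrder.Language.{u, v}) : Type max u v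
  | eq : L.Term Empty → L.Term Empty → QFF L
  | fls : QFF L
  | not : QFF L → QFF L
  | and : QFF L → QFF L → QFF L
  | or : QFF L → QFF L → QFF L
  | imp : QFF L → QFF L → QFF L

/-- Truth of a quantifier-free sentence in a structure. -/
def QFF.Holds {L : FirstOrder.Language.{u, v}} (M : Type) (str : L.Structure M) :
    QFF L → Prop
  | eq s t => gval M str s = gval M str t
  | fls => False
  | not a => ¬ a.Holds M str
  | and a b => a.Holds M str ∧ b.Holds M str
  | or a b => a.Holds M str ∨ b.Holds M str
  | imp a b => a.Holds M str → b.Holds M str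

/-- The function symbols occurring in a quantifier-free sentence. -/
def QFF.funcs {L : FirstOrder.Language.{u, v}} :
    QFF L → Set (Σ n, L.Functions n)
  | eq s t => {g | TFunc g s ∨ TFunc g t}
  | fls => ∅
  | not a => a.funcs
  | and a b => a.funcs ∪ b.funcs
  | or a b => a.funcs ∪ b.funcs
  | imp a b => a.funcs ∪ b.funcs

open Filter

namespace EUF

variable {L : FirstOrder.Language.{u, v}}

/-- The terms all of whose function symbols lie in `F`. -/
def termsOver (F : Set (Σ n, L.Functions n)) : Set (L.Term Empty) :=
  {t | ∀ g, TFunc g t → g ∈ F}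

theorem func_mem_of_mem_termsOver {F : Set (Σ n, L.Functions n)} {k : ℕ} {f : L.Functions k}
    {ts : Fin k → L.Term Empty} (h : Term.func f ts ∈ termsOver F) : ⟨k, f⟩ ∈ F :=
  h _ (TFunc.head f ts)

theorem arg_mem_termsOver {F : Set (Σ n, L.Functions n)} {k : ℕ} {f : L.Functions k}
    {ts : Fin k → L.Term Empty} (h : Term.func f ts ∈ termsOver F) (i : Fin k) :
    ts i ∈ termsOver F :=
  fun _ hg => h _ (TFunc.arg f ts i hg)

theorem func_mem_termsOver {F : Set (Σ n, L.Functions n)} {k : ℕ} {f : L.Functions k}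
    {ts : Fin k → L.Term Empty} (hf : ⟨k, f⟩ ∈ F) (hts : ∀ i, ts i ∈ termsOver F) :
    Term.func f ts ∈ termsOver F := by
  intro g hg
  cases hg with
  | head => exact hf
  | arg _ _ i hi => exact hts i _ hi

theorem finite_setOf_tFunc (t : L.Term Empty) : {g | TFunc g t}.Finite := by
  induction t with
  | var e => exact e.elim
  | func f ts ih =>
    refine ((Set.finite_singleton ⟨_, f⟩).union (Set.finite_iUnion ih)).subset ?_
    intro g hg
    cases hg with
    | head => exact Or.inl rfl
    | arg _ _ i hi => exact Or.inr (Set.mem_iUnion.2 ⟨i, hi⟩)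

theorem finite_funcs (φ : QFF L) : φ.funcs.Finite := by
  induction φ with
  | eq s t => exact (finite_setOf_tFunc s).union (finite_setOf_tFunc t)
  | fls => exact Set.finite_empty
  | not _ ih => exact ih
  | and _ _ ih₁ ih₂ | or _ _ ih₁ ih₂ | imp _ _ ih₁ ih₂ => exact ih₁.union ih₂

theorem countable_termsOver {F : Set (Σ n, L.Functions n)} (hF : F.Countable) :
    (termsOver F).Countable := by
  let L' : FirstOrder.Language := ⟨fun n => {f : L.Functions n // ⟨n, f⟩ ∈ F}, fun _ => Empty⟩
  let ι : L' →ᴸ L := ⟨fun _ f => f.1, fun _ r => r.elim⟩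
  have : Countable F := hF
  have : Countable (Σ n, L'.Functions n) := by
    refine Function.Injective.countable (f := fun p => (⟨⟨p.1, p.2.1⟩, p.2.2⟩ : F)) ?_
    rintro ⟨n, f, hf⟩ ⟨m, g, hg⟩ h
    simp only [Subtype.mk.injEq, Sigma.mk.injEq] at h
    obtain ⟨rfl, h⟩ := h
    obtain rfl := eq_of_heq h
    rfl
  refine (Set.countable_range (ι.onTerm (α := Empty))).mono ?_
  intro t ht
  induction t with
  | var e => exact e.elim
  | func f ts ih =>
    choose us hus using fun i => ih i (arg_mem_termsOver ht i)
    exact ⟨Term.func (⟨f, func_mem_of_mem_termsOver ht⟩ : L'.Functions _) us,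
      congrArg (Term.func f) (funext hus)⟩

theorem gval_func {M : Type} (str : L.Structure M) {k : ℕ} (f : L.Functions k)
    (ts : Fin k → L.Term Empty) :
    gval M str (Term.func f ts) = str.funMap f fun i => gval M str (ts i) := rfl

/-- The truth of a quantifier-free sentence is determined by the equations true between ground
terms over its function symbols. -/
theorem holds_congr {M N : Type} {sM : L.Structure M} {sN : L.Structure N} (φ : QFF L)
    (h : ∀ s ∈ termsOver φ.funcs, ∀ t ∈ termsOver φ.funcs,
      (gval M sM s = gval M sM t ↔ gval N sN s = gval N sN t)) :
    φ.Holds M sM ↔ φ.Holds N sN := by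
  have mono {F G : Set (Σ n, L.Functions n)} (hFG : F ⊆ G) {t : L.Term Empty}
      (ht : t ∈ termsOver F) : t ∈ termsOver G := fun g hg => hFG (ht g hg)
  induction φ with
  | eq s t => exact h s (fun g hg => Or.inl hg) t (fun g hg => Or.inr hg)
  | fls => rfl
  | not _ ih => exact not_congr (ih h)
  | and _ _ ih₁ ih₂ =>
    exact and_congr
      (ih₁ fun s hs t ht => h s (mono Set.subset_union_left hs) t (mono Set.subset_union_left ht))
      (ih₂ fun s hs t ht => h s (mono Set.subset_union_right hs) t (mono Set.subset_union_right ht))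
  | or _ _ ih₁ ih₂ =>
    exact or_congr
      (ih₁ fun s hs t ht => h s (mono Set.subset_union_left hs) t (mono Set.subset_union_left ht))
      (ih₂ fun s hs t ht => h s (mono Set.subset_union_right hs) t (mono Set.subset_union_right ht))
  | imp _ _ ih₁ ih₂ =>
    exact imp_congr
      (ih₁ fun s hs t ht => h s (mono Set.subset_union_left hs) t (mono Set.subset_union_left ht))
      (ih₂ fun s hs t ht => h s (mono Set.subset_union_right hs) t (mono Set.subset_union_right ht))

/-- Truth is reflected along an injection that commutes with the evaluation of terms. -/
theorem holds_iff_of_injective {M N : Type} {sM : L.Structure M} {sN : L.Structure N} {i : M → N}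
    (hi : Function.Injective i) (φ : QFF L)
    (h : ∀ t ∈ termsOver φ.funcs, gval N sN t = i (gval M sM t)) :
    φ.Holds N sN ↔ φ.Holds M sM :=
  holds_congr φ fun s hs t ht => by rw [h s hs, h t ht, hi.eq_iff]

section Ultraproduct

variable {ι : Type} (U : Ultrafilter ι) (M : ι → Type) (str : ∀ n, L.Structure (M n))

/-- The ultraproduct structure. -/
noncomputable abbrev ultra : L.Structure ((U : Filter ι).Product M) :=
  letI := str
  Language.Ultraproduct.structure

theorem gval_ultra_eq_iff (s t : L.Term Empty) :
    gval _ (ultra U M str) s = gval _ (ultra U M str) t ↔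
      ∀ᶠ n in U, gval (M n) (str n) s = gval (M n) (str n) t := by
  let := str
  have key (t : L.Term Empty) : gval _ (ultra U M str) t =
      ((fun n => gval (M n) (str n) t : ∀ n, M n) : (U : Filter ι).Product M) := by
    induction t with
    | var e => exact e.elim
    | func f ts ih =>
      rw [gval_func, funext ih]
      exact Language.Ultraproduct.funMap_cast f fun i n => gval (M n) (str n) (ts i)
  rw [key, key]
  exact Quotient.eq''

theorem holds_ultra_iff (φ : QFF L) :
    φ.Holds _ (ultra U M str) ↔ ∀ᶠ n in U, φ.Holds (M n) (str n) := by
  induction φ with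
  | eq s t => exact gval_ultra_eq_iff U M str s t
  | fls => exact eventually_const.symm
  | not _ ih => simp only [QFF.Holds, ih, Ultrafilter.eventually_not]
  | and _ _ ih₁ ih₂ => simp only [QFF.Holds, ih₁, ih₂, eventually_and]
  | or _ _ ih₁ ih₂ => simp only [QFF.Holds, ih₁, ih₂, Ultrafilter.eventually_or]
  | imp _ _ ih₁ ih₂ => simp only [QFF.Holds, ih₁, ih₂, Ultrafilter.eventually_imp]

end Ultraproduct

/-- For finitely many equations over `F` and a class `K` of structures, some quantifier-free
sentence over `F` defines the structures that agree on these equations with a member of `K`. -/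
theorem exists_defining_sentence (F : Set (Σ n, L.Functions n))
    (l : List (L.Term Empty × L.Term Empty))
    (hl : ∀ p ∈ l, p.1 ∈ termsOver F ∧ p.2 ∈ termsOver F)
    (K : ∀ M : Type, L.Structure M → Prop) :
    ∃ I : QFF L, I.funcs ⊆ F ∧ ∀ (N : Type) (sN : L.Structure N), I.Holds N sN ↔
      ∃ (M : Type) (sM : L.Structure M), K M sM ∧
        ∀ p ∈ l, (gval M sM p.1 = gval M sM p.2 ↔ gval N sN p.1 = gval N sN p.2) := by
  induction l generalizing K with
  | nil =>
    by_cases hK : ∃ (M : Type) (sM : L.Structure M), K M sM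
    · exact ⟨.not .fls, by simp [QFF.funcs], fun _ _ => by simpa [QFF.Holds] using hK⟩
    · exact ⟨.fls, by simp [QFF.funcs], fun _ _ => by simpa [QFF.Holds] using hK⟩
  | cons p l ih =>
    have hl' : ∀ q ∈ l, q.1 ∈ termsOver F ∧ q.2 ∈ termsOver F :=
      fun q hq => hl q (List.mem_cons_of_mem _ hq)
    obtain ⟨I, hIF, hI⟩ := ih hl' fun M sM => K M sM ∧ gval M sM p.1 = gval M sM p.2
    obtain ⟨J, hJF, hJ⟩ := ih hl' fun M sM => K M sM ∧ ¬ gval M sM p.1 = gval M sM p.2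
    have hp : (QFF.eq p.1 p.2).funcs ⊆ F := by
      rintro g (hg | hg)
      exacts [(hl p List.mem_cons_self).1 g hg, (hl p List.mem_cons_self).2 g hg]
    refine ⟨.or (.and (.eq p.1 p.2) I) (.and (.not (.eq p.1 p.2)) J),
      Set.union_subset (Set.union_subset hp hIF) (Set.union_subset hp hJF), fun N sN => ?_⟩
    simp only [QFF.Holds, hI, hJ, List.forall_mem_cons]
    constructor
    · rintro (⟨hN, M, sM, ⟨hK, hM⟩, h⟩ | ⟨hN, M, sM, ⟨hK, hM⟩, h⟩)
      · exact ⟨M, sM, hK, iff_of_true hM hN, h⟩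
      · exact ⟨M, sM, hK, iff_of_false hM hN, h⟩
    · rintro ⟨M, sM, hK, hp, h⟩
      by_cases hN : gval N sN p.1 = gval N sN p.2
      · exact Or.inl ⟨hN, M, sM, ⟨hK, hp.2 hN⟩, h⟩
      · exact Or.inr ⟨hN, M, sM, ⟨hK, mt hp.1 hN⟩, h⟩

/-- Structures with the same true equations between ground terms over `F ∩ G` amalgamate to a
structure extending the first one on terms over `F` and the second one on terms over `G`. -/
theorem exists_amalgam {M N : Type} [Nonempty M] (sM : L.Structure M) (sN : L.Structure N)
    (F G : Set (Σ n, L.Functions n))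
    (h : ∀ s ∈ termsOver (F ∩ G), ∀ t ∈ termsOver (F ∩ G),
      (gval M sM s = gval M sM t ↔ gval N sN s = gval N sN t)) :
    ∃ (W : Type) (sW : L.Structure W) (i : M → W) (j : N → W),
      Function.Injective i ∧ Function.Injective j ∧
      (∀ t ∈ termsOver F, gval W sW t = i (gval M sM t)) ∧
      (∀ t ∈ termsOver G, gval W sW t = j (gval N sN t)) := by
  classical
  let j : N → M ⊕ N := fun n =>
    if hn : ∃ t ∈ termsOver (F ∩ G), gval N sN t = n then .inl (gval M sM hn.choose) else .inr n
  have j_gval (t) (ht : t ∈ termsOver (F ∩ G)) : j (gval N sN t) = .inl (gval M sM t) := by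
    have hn : ∃ s ∈ termsOver (F ∩ G), gval N sN s = gval N sN t := ⟨t, ht, rfl⟩
    simp only [j, dif_pos hn]
    exact congrArg _ ((h _ hn.choose_spec.1 _ ht).2 hn.choose_spec.2)
  have j_eq_inl {n : N} {m : M} (hnm : j n = .inl m) :
      ∃ t ∈ termsOver (F ∩ G), gval N sN t = n ∧ gval M sM t = m := by
    by_cases hn : ∃ t ∈ termsOver (F ∩ G), gval N sN t = n
    · simp only [j, dif_pos hn, Sum.inl.injEq] at hnm
      exact ⟨_, hn.choose_spec.1, hn.choose_spec.2, hnm⟩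
    · simp [j, dif_neg hn] at hnm
  have j_eq_inr {n n' : N} (hn : j n = .inr n') : n = n' := by
    by_cases hn' : ∃ t ∈ termsOver (F ∩ G), gval N sN t = n
    · simp [j, dif_pos hn'] at hn
    · simpa [j, dif_neg hn'] using hn
  have j_inj : Function.Injective j := by
    intro n n' hnn
    rcases hj : j n' with m | m
    · obtain ⟨s, hs, rfl, hsm⟩ := j_eq_inl (hnn.trans hj)
      obtain ⟨t, ht, rfl, htm⟩ := j_eq_inl hj
      exact (h s hs t ht).1 (hsm.trans htm.symm)
    · exact (j_eq_inr (hnn.trans hj)).trans (j_eq_inr hj).symm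
  let sW : L.Structure (M ⊕ N) :=
    { funMap := fun {k} f w =>
        if hM : ⟨k, f⟩ ∈ F ∧ ∃ m : Fin k → M, w = fun a => .inl (m a) then
          .inl (sM.funMap f hM.2.choose)
        else if hN : ∃ n : Fin k → N, w = fun a => j (n a) then j (sN.funMap f hN.choose)
        else .inl (Classical.arbitrary M)
      RelMap := fun _ _ => False }
  have inl_gval (t) (ht : t ∈ termsOver F) : gval _ sW t = .inl (gval M sM t) := by
    induction t with
    | var e => exact e.elim
    | @func k f ts ih =>
      rw [gval_func, funext fun a => ih a (arg_mem_termsOver ht a), gval_func]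
      have hM : ⟨k, f⟩ ∈ F ∧ ∃ m : Fin k → M,
          (fun a => (.inl (gval M sM (ts a)) : M ⊕ N)) = fun a => .inl (m a) :=
        ⟨func_mem_of_mem_termsOver ht, _, rfl⟩
      have hm : (fun a => gval M sM (ts a)) = hM.2.choose :=
        funext fun a => Sum.inl_injective (congrFun hM.2.choose_spec a)
      exact (dif_pos hM).trans (congrArg (fun m => Sum.inl (sM.funMap f m)) hm.symm)
  refine ⟨M ⊕ N, sW, .inl, j, Sum.inl_injective, j_inj, inl_gval, fun t ht => ?_⟩
  induction t with
  | var e => exact e.elim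
  | @func k f ts ih =>
    rw [gval_func, funext fun a => ih a (arg_mem_termsOver ht a), gval_func]
    by_cases hM : ⟨k, f⟩ ∈ F ∧ ∃ m : Fin k → M,
        (fun a => j (gval N sN (ts a))) = fun a => .inl (m a)
    · refine (dif_pos hM).trans ?_
      choose us hus husN husM using fun a => j_eq_inl (congrFun hM.2.choose_spec a)
      have hf : Term.func f us ∈ termsOver (F ∩ G) :=
        func_mem_termsOver ⟨hM.1, func_mem_of_mem_termsOver ht⟩ hus
      rw [← funext husM, ← funext husN]
      exact (j_gval _ hf).symm
    · have hN : ∃ n : Fin k → N, (fun a => j (gval N sN (ts a))) = fun a => j (n a) := ⟨_, rfl⟩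
      have hn : (fun a => gval N sN (ts a)) = hN.choose :=
        funext fun a => j_inj (congrFun hN.choose_spec a)
      exact ((dif_neg hM).trans (dif_pos hN)).trans
        (congrArg (fun n => j (sN.funMap f n)) hn.symm)

/-- If all finite sets of equations over `F` admit models of `A` and of `B` agreeing on them, then
some models of `A` and `B` agree on all equations over `F`. -/
theorem exists_models_agreeing {F : Set (Σ n, L.Functions n)} (hF : F.Countable) (A B : QFF L)
    (h : ∀ l : List (L.Term Empty × L.Term Empty),
      (∀ p ∈ l, p.1 ∈ termsOver F ∧ p.2 ∈ termsOver F) →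
      ∃ (M N : Type) (sM : L.Structure M) (sN : L.Structure N), Nonempty M ∧
        A.Holds M sM ∧ B.Holds N sN ∧
        ∀ p ∈ l, (gval M sM p.1 = gval M sM p.2 ↔ gval N sN p.1 = gval N sN p.2)) :
    ∃ (M N : Type) (sM : L.Structure M) (sN : L.Structure N), Nonempty M ∧
      A.Holds M sM ∧ B.Holds N sN ∧
      ∀ s ∈ termsOver F, ∀ t ∈ termsOver F,
        (gval M sM s = gval M sM t ↔ gval N sN s = gval N sN t) := by
  have hS : Countable (termsOver F) := countable_termsOver hF
  obtain ⟨e, he⟩ := exists_surjective_nat (Option (termsOver F × termsOver F))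
  choose M N sM sN hne hA hB hMN using fun n =>
    h (((List.range n).filterMap e).map fun p => (p.1.1, p.2.1)) (by
      intro p hp
      obtain ⟨q, -, rfl⟩ := List.mem_map.1 hp
      exact ⟨q.1.2, q.2.2⟩)
  let U : Ultrafilter ℕ := hyperfilter ℕ
  refine ⟨_, _, ultra U M sM, ultra U N sN,
    ⟨((fun n => Classical.choice (hne n) : ∀ n, M n) : (U : Filter ℕ).Product M)⟩,
    (holds_ultra_iff U M sM A).2 (Eventually.of_forall hA),
    (holds_ultra_iff U N sN B).2 (Eventually.of_forall hB), fun s hs t ht => ?_⟩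
  rw [gval_ultra_eq_iff, gval_ultra_eq_iff]
  obtain ⟨k, hk⟩ := he (some (⟨s, hs⟩, ⟨t, ht⟩))
  have hlarge : ∀ᶠ n in (U : Filter ℕ), k < n :=
    (Nat.hyperfilter_le_atTop) (eventually_gt_atTop k)
  refine eventually_congr (hlarge.mono fun n hn => hMN n (s, t) ?_)
  exact List.mem_map.2
    ⟨(⟨s, hs⟩, ⟨t, ht⟩), List.mem_filterMap.2 ⟨k, List.mem_range.2 hn, hk⟩, rfl⟩

end EUF

/-- EUF has the ground interpolation property: for all
quantifier-free sentences `A`, `B` (over a signature of function symbols) such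
that `{A, B}` is unsatisfiable in first-order logic with equality, there is a
quantifier-free sentence `I` all of whose function symbols occur in both `A` and
`B`, with `A ⊨ I` and `{B, I}` unsatisfiable. -/
theorem euf_ground_interpolation
    {L : FirstOrder.Language.{u, v}} (A B : QFF L)
    (hunsat : ¬ ∃ (M : Type) (str : L.Structure M), Nonempty M ∧
      A.Holds M str ∧ B.Holds M str) :
    ∃ I : QFF L, I.funcs ⊆ A.funcs ∩ B.funcs ∧
      (∀ (M : Type) (str : L.Structure M), Nonempty M → A.Holds M str → I.Holds M str) ∧
      (¬ ∃ (M : Type) (str : L.Structure M), Nonempty M ∧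
        B.Holds M str ∧ I.Holds M str) := by
  by_contra hno
  obtain ⟨M, N, sM, sN, hne, hA, hB, hMN⟩ := EUF.exists_models_agreeing
    ((EUF.finite_funcs A).inter_of_left B.funcs).countable A B (by
      intro l hl
      obtain ⟨I, hIF, hI⟩ := EUF.exists_defining_sentence _ l hl
        fun M sM => Nonempty M ∧ A.Holds M sM
      by_contra hl'
      refine hno ⟨I, hIF, fun M sM hne hA => (hI M sM).2 ⟨M, sM, ⟨hne, hA⟩, fun _ _ => Iff.rfl⟩, ?_⟩
      rintro ⟨N, sN, -, hB, hIN⟩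
      obtain ⟨M, sM, ⟨hne, hA⟩, hMN⟩ := (hI N sN).1 hIN
      exact hl' ⟨M, N, sM, sN, hne, hA, hB, hMN⟩)
  obtain ⟨W, sW, i, j, hi, hj, hiA, hjB⟩ := EUF.exists_amalgam sM sN A.funcs B.funcs hMN
  exact hunsat ⟨W, sW, hne.map i, (EUF.holds_iff_of_injective hi A hiA).2 hA,
    (EUF.holds_iff_of_injective hj B hjB).2 hB⟩
end

section
/- Let 𝒯 be a first-order theory over a signature Σ, let A and B be disjoint sets of sentences over expansions of Σ by free symbols, and let Σ_I be the expansion of Σ by the free symbols occurring in both A and B. Let (S_A, S_B, ⊏) be a 𝒯-interpolation run for A and B: S_A and S_B are disjoint finite sets of Σ_I-sentences, ⊏ is a well-founded partial order on S_A ∪ S_B, and there are functions prB : S_A → 2^{S_B} and prA : S_B → 2^{S_A} such that (1) for every α ∈ S_A, A ∪ prB(α) ⊨_𝒯 α and β ⊏ α for all β ∈ prB(α), and (2) for every β ∈ S_B, B ∪ prA(β) ⊨_𝒯 β and α ⊏ β for all α ∈ prA(β). Then for every β ∈ S_B there exists a finite set I(β) of Σ_I-sentences such that A ⊨_𝒯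 φ for every φ ∈ I(β), and B ∪ I(β) ⊨_𝒯 β. -/
open FirstOrder Language

universe u v

/-- A function symbol occurs in a bounded formula. -/
inductive FFunc {L : FirstOrder.Language.{u, v}} {α : Type*} :
    ∀ {n : ℕ}, (Σ k, L.Functions k) → L.BoundedFormula α n → Prop
  | equal_l {n} {t₁ t₂ : L.Term (α ⊕ Fin n)} {g} (h : TFunc g t₁) :
      FFunc g (BoundedFormula.equal t₁ t₂)
  | equal_r {n} {t₁ t₂ : L.Term (α ⊕ Fin n)} {g} (h : TFunc g t₂) :
      FFunc g (BoundedFormula.equal t₁ t₂)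
  | rel {n l : ℕ} {R : L.Relations l} {ts : Fin l → L.Term (α ⊕ Fin n)} {g} (i : Fin l)
      (h : TFunc g (ts i)) : FFunc g (BoundedFormula.rel R ts)
  | imp_l {n} {φ ψ : L.BoundedFormula α n} {g} (h : FFunc g φ) : FFunc g (φ.imp ψ)
  | imp_r {n} {φ ψ : L.BoundedFormula α n} {g} (h : FFunc g ψ) : FFunc g (φ.imp ψ)
  | all {n} {φ : L.BoundedFormula α (n + 1)} {g} (h : FFunc g φ) : FFunc g φ.all

/-- A relation symbol occurs in a bounded formula. -/
inductive FRel {L : FirstOrder.Language.{u, v}} {α : Type*} :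
    ∀ {n : ℕ}, (Σ k, L.Relations k) → L.BoundedFormula α n → Prop
  | rel {n l : ℕ} {R : L.Relations l} {ts : Fin l → L.Term (α ⊕ Fin n)} :
      FRel ⟨l, R⟩ (BoundedFormula.rel R ts)
  | imp_l {n} {φ ψ : L.BoundedFormula α n} {g} (h : FRel g φ) : FRel g (φ.imp ψ)
  | imp_r {n} {φ ψ : L.BoundedFormula α n} {g} (h : FRel g ψ) : FRel g (φ.imp ψ)
  | all {n} {φ : L.BoundedFormula α (n + 1)} {g} (h : FRel g φ) : FRel g φ.all

/-- A structure (given explicitly) satisfies every sentence in `S`. -/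
def SatisfiesAll {L : FirstOrder.Language.{u, v}} (M : Type) (str : L.Structure M)
    (S : Set L.Sentence) : Prop :=
  letI := str
  ∀ φ ∈ S, M ⊨ φ

/-- `S ⊨_T φ` : semantic entailment modulo the theory `T`. -/
def TEntails {L : FirstOrder.Language.{u, v}} (T : L.Theory) (S : Set L.Sentence)
    (φ : L.Sentence) : Prop :=
  ∀ (M : Type) (str : L.Structure M), Nonempty M →
    SatisfiesAll M str T → SatisfiesAll M str S → (letI := str; M ⊨ φ)

/-- The theory uses only symbols of the signature given by `SF`, `SR`. -/
def TheoryOverSig {L : FirstOrder.Language.{u, v}} (SF : Set (Σ k, L.Functions k))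
    (SR : Set (Σ k, L.Relations k)) (T : L.Theory) : Prop :=
  ∀ φ ∈ T, (∀ g, FFunc g φ → g ∈ SF) ∧ (∀ g, FRel g φ → g ∈ SR)

/-- `φ` is a `Σ_I`-sentence: each of its non-theory symbols occurs both in `A`
and in `B`. -/
def SigISentence {L : FirstOrder.Language.{u, v}} (SF : Set (Σ k, L.Functions k))
    (SR : Set (Σ k, L.Relations k)) (A B : Set L.Sentence) (φ : L.Sentence) : Prop :=
  (∀ g, FFunc g φ → g ∉ SF → (∃ ψ ∈ A, FFunc g ψ) ∧ ∃ ψ ∈ B, FFunc g ψ) ∧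
  (∀ g, FRel g φ → g ∉ SR → (∃ ψ ∈ A, FRel g ψ) ∧ ∃ ψ ∈ B, FRel g ψ)

/-- The iterated implication `b₁ → b₂ → ⋯ → φ` with premises taken from a list. -/
def impList {L : FirstOrder.Language.{u, v}} (l : List L.Sentence) (φ : L.Sentence) :
    L.Sentence :=
  l.foldr (fun b ψ => BoundedFormula.imp b ψ) φ

theorem realize_impList {L : FirstOrder.Language.{u, v}} {M : Type*} [L.Structure M]
    (l : List L.Sentence) (φ : L.Sentence) :
    M ⊨ impList l φ ↔ ((∀ b ∈ l, M ⊨ b) → M ⊨ φ) := by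
  induction l with
  | nil => simp [impList]
  | cons b l ih =>
    have h : M ⊨ impList (b :: l) φ ↔ (M ⊨ b → M ⊨ impList l φ) := BoundedFormula.realize_imp
    rw [h, ih, List.forall_mem_cons, and_imp]

theorem SigISentence.imp {L : FirstOrder.Language.{u, v}} {SF : Set (Σ k, L.Functions k)}
    {SR : Set (Σ k, L.Relations k)} {A B : Set L.Sentence} {φ ψ : L.Sentence}
    (hφ : SigISentence SF SR A B φ) (hψ : SigISentence SF SR A B ψ) :
    SigISentence SF SR A B (BoundedFormula.imp φ ψ) := by
  constructor
  · rintro g (_ | _ | _ | h | h | _) hg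
    exacts [hφ.1 g h hg, hψ.1 g h hg]
  · rintro g (_ | h | h | _) hg
    exacts [hφ.2 g h hg, hψ.2 g h hg]

theorem SigISentence.impList {L : FirstOrder.Language.{u, v}} {SF : Set (Σ k, L.Functions k)}
    {SR : Set (Σ k, L.Relations k)} {A B : Set L.Sentence} {l : List L.Sentence}
    {φ : L.Sentence} (hl : ∀ b ∈ l, SigISentence SF SR A B b)
    (hφ : SigISentence SF SR A B φ) : SigISentence SF SR A B (impList l φ) := by
  induction l with
  | nil => exact hφ
  | cons b l ih =>
    exact (hl b List.mem_cons_self).imp (ih fun c hc => hl c (List.mem_cons_of_mem _ hc))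

/-- Given a `T`-interpolation run `(SA, SB, lt)` for `A` and `B`,
for every `β ∈ SB` there is a finite set `I` of `Σ_I`-sentences each entailed by
`A` modulo `T` and such that `B ∪ I ⊨_T β`. -/
theorem interpolation_run_partial_interpolants
    {L : FirstOrder.Language.{u, v}} (SF : Set (Σ k, L.Functions k))
    (SR : Set (Σ k, L.Relations k)) (T : L.Theory) (hT : TheoryOverSig SF SR T)
    (A B : Set L.Sentence) (hABdisj : Disjoint A B)
    (SA SB : Set L.Sentence) (hSdisj : Disjoint SA SB)
    (hSAfin : SA.Finite) (hSBfin : SB.Finite)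
    (hSsig : ∀ φ ∈ SA ∪ SB, SigISentence SF SR A B φ)
    (lt : L.Sentence → L.Sentence → Prop)
    (hwf : WellFounded lt) (htrans : Transitive lt)
    (prB prA : L.Sentence → Set L.Sentence)
    (hprB : ∀ α ∈ SA, prB α ⊆ SB ∧ TEntails T (A ∪ prB α) α ∧ ∀ β ∈ prB α, lt β α)
    (hprA : ∀ β ∈ SB, prA β ⊆ SA ∧ TEntails T (B ∪ prA β) β ∧ ∀ α ∈ prA β, lt α β) :
    ∀ β ∈ SB, ∃ I : Set L.Sentence, I.Finite ∧
      (∀ φ ∈ I, SigISentence SF SR A B φ) ∧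
      (∀ φ ∈ I, TEntails T A φ) ∧
      TEntails T (B ∪ I) β := by
  intro β
  induction β using hwf.induction with
  | h β ih =>
  intro hβ
  choose! I hIfin hIsig hIA hIB using ih
  obtain ⟨hsub, hent, hlt⟩ := hprA β hβ
  have hfinB : ∀ α ∈ prA β, (prB α).Finite := fun α hα => hSBfin.subset (hprB α (hsub hα)).1
  choose! s hs using fun α hα => (hfinB α hα).exists_finset
  have hbelow : ∀ α ∈ prA β, ∀ γ ∈ prB α, lt γ β ∧ γ ∈ SB := fun α hα γ hγ =>
    ⟨htrans ((hprB α (hsub hα)).2.2 γ hγ) (hlt α hα), (hprB α (hsub hα)).1 hγ⟩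
  refine ⟨⋃ α ∈ prA β, {impList (s α).toList α} ∪ ⋃ γ ∈ prB α, I γ, ?_, ?_, ?_, ?_⟩
  · exact (hSAfin.subset hsub).biUnion fun α hα => (Set.finite_singleton _).union <|
      (hfinB α hα).biUnion fun γ hγ => hIfin γ (hbelow α hα γ hγ).1 (hbelow α hα γ hγ).2
  · intro φ hφ
    simp only [Set.mem_iUnion, Set.mem_union, Set.mem_singleton_iff] at hφ
    obtain ⟨α, hα, rfl | ⟨γ, hγ, hφ⟩⟩ := hφ
    · refine SigISentence.impList (fun b hb => hSsig b (Or.inr ?_)) (hSsig α (Or.inl (hsub hα)))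
      exact (hprB α (hsub hα)).1 ((hs α hα b).1 (Finset.mem_toList.1 hb))
    · exact hIsig γ (hbelow α hα γ hγ).1 (hbelow α hα γ hγ).2 φ hφ
  · intro φ hφ
    simp only [Set.mem_iUnion, Set.mem_union, Set.mem_singleton_iff] at hφ
    obtain ⟨α, hα, rfl | ⟨γ, hγ, hφ⟩⟩ := hφ
    · intro M str hM hMT hMA
      refine (realize_impList _ _).2 fun hb => (hprB α (hsub hα)).2.1 M str hM hMT ?_
      rintro ψ (hψ | hψ)
      · exact hMA ψ hψ
      · exact hb ψ (Finset.mem_toList.2 ((hs α hα ψ).2 hψ))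
    · exact hIA γ (hbelow α hα γ hγ).1 (hbelow α hα γ hγ).2 φ hφ
  · intro M str hM hMT hMB
    refine hent M str hM hMT ?_
    rintro ψ (hψ | hψ)
    · exact hMB ψ (Or.inl hψ)
    · have hI : ∀ φ ∈ {impList (s ψ).toList ψ} ∪ ⋃ γ ∈ prB ψ, I γ, M ⊨ φ := fun φ hφ =>
        hMB φ (Or.inr (Set.mem_biUnion hψ hφ))
      refine (realize_impList _ _).1 (hI _ (Or.inl rfl)) fun γ hγ => ?_
      replace hγ : γ ∈ prB ψ := (hs ψ hψ γ).1 (Finset.mem_toList.1 hγ)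
      refine hIB γ (hbelow ψ hψ γ hγ).1 (hbelow ψ hψ γ hγ).2 M str hM hMT ?_
      rintro φ (hφ | hφ)
      · exact hMB φ (Or.inl hφ)
      · exact hI φ (Or.inr (Set.mem_biUnion hγ hφ))
end
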